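/- Let d ≥ 3, κ ≥ 2d. There exists a constant C = C(d,κ) > 0 such that for all continuously differentiable α₁, α₂ : ℝ^{2d} → ℂ with ‖α_i‖_{A^{κ,2}} < ∞ and ‖∇_v α_i‖_{A^{κ,2}} < ∞, the phase forces K_i(x) := −∫_{ℝ^d} ∇Γ(x−y) · φ_i(y) dy, where φ_i(y) := ∫_{ℝ^d} conj(α_i)(y,w) ∇_w α_i(y,w) dw, satisfy ‖K₁ − K₂‖_{L^∞(ℝ^d)} ≤ C (‖∇_v α₁‖_{A^{κ,2}} + ‖∇_v α₂‖_{A^{κ,2}}) ‖α₁ − α₂‖_{A^{κ,2}}. -/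

import Mathlib

open MeasureTheory
open scoped ENNReal NNReal

/-- `ℝ^d` as a Euclidean space. -/
abbrev E (d : ℕ) : Type := EuclideanSpace ℝ (Fin d)

/-- The `A^{κ,p}` norm: `sup_{R ≥ 0} (1+R)^{-κ/p} (∫ sup_{|z̄| ≤ R} ‖f(z+z̄)‖^p dz)^{1/p}`. -/
noncomputable def Anorm {G F : Type*} [NormedAddCommGroup G] [MeasureSpace G]
    [NormedAddCommGroup F] (κ p : ℝ) (f : G → F) : ℝ≥0∞ :=
  ⨆ R : NNReal, (ENNReal.ofReal (1 + (R : ℝ))) ^ (-(κ / p)) *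
    (∫⁻ z, ⨆ w ∈ Metric.closedBall (0 : G) (R : ℝ),
      ENNReal.ofReal (‖f (z + w)‖ ^ p)) ^ (1 / p)

/-- The gradient `∇Γ(x) = x / (c_d |x|^d)` of the Newtonian potential on `ℝ^d`,
where `c_d = d·ω_d` is the surface measure of the unit sphere `S^{d-1}`. -/
noncomputable def gradNewton (d : ℕ) (x : E d) : E d :=
  (((d : ℝ) * (volume (Metric.ball (0 : E d) 1)).toReal) * ‖x‖ ^ (d : ℝ))⁻¹ • x

/-- The velocity gradient `∇ᵥα` of a function on phase space, as a continuous linear map. -/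
noncomputable def gradV (d : ℕ) (α : E d × E d → ℂ) (z : E d × E d) : E d →L[ℝ] ℂ :=
  fderiv ℝ (fun w : E d => α (z.1, w)) z.2

/-- The phase density `φ(x) = ∫ conj(α)(x,v) ∇ᵥα(x,v) dv`. -/
noncomputable def phaseDensity (d : ℕ) (α : E d × E d → ℂ) (x : E d) : E d →L[ℝ] ℂ :=
  ∫ v : E d, (starRingEnd ℂ) (α (x, v)) • gradV d α (x, v)

/-- The phase force `K(x) = −∫ ∇Γ(x−y)·φ(y) dy`, where `·` is the componentwise
pairing of `ℝ^d` with `ℂ^d` (i.e. `φ(y)` applied to the vector `∇Γ(x−y)`). -/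
noncomputable def phaseForce (d : ℕ) (α : E d × E d → ℂ) (x : E d) : ℂ :=
  -∫ y : E d, phaseDensity d α y (gradNewton d (x - y))

open Metric

section SliceBounds

variable {d : ℕ} {F G : Type*} [NormedAddCommGroup F] [NormedAddCommGroup G]

/-- The constant in `eLpNorm_slice_le`. -/
noncomputable def sliceConst (d : ℕ) (κ : ℝ) : ℝ≥0∞ :=
  (volume (ball (0 : E d) 1))⁻¹ ^ (1 / 2 : ℝ) * 2 ^ (κ / 2)

theorem sliceConst_ne_top (d : ℕ) (κ : ℝ) : sliceConst d κ ≠ ⊤ := by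
  have h : volume (ball (0 : E d) 1) ≠ 0 := (measure_ball_pos _ _ one_pos).ne'
  refine ENNReal.mul_ne_top ?_ ?_
  · exact ENNReal.rpow_ne_top_of_nonneg (by norm_num) (ENNReal.inv_ne_top.2 h)
  · exact ENNReal.rpow_ne_top_of_ne_zero (by norm_num) (by norm_num)

theorem eLpNorm_two_eq {X : Type*} [MeasurableSpace X] (μ : Measure X) (f : X → F) :
    eLpNorm f 2 μ = (∫⁻ x, ‖f x‖ₑ ^ (2 : ℝ) ∂μ) ^ (1 / 2 : ℝ) := by
  simp [eLpNorm_eq_lintegral_rpow_enorm_toReal]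

theorem ofReal_norm_rpow_two (a : F) : ENNReal.ofReal (‖a‖ ^ (2 : ℝ)) = ‖a‖ₑ ^ (2 : ℝ) := by
  rw [← ENNReal.ofReal_rpow_of_nonneg (norm_nonneg _) (by norm_num), ofReal_norm]

theorem measurable_iSup_closedBall {f : E d × E d → F} (hf : Continuous f) (R : ℝ) :
    Measurable fun z => ⨆ w ∈ closedBall (0 : E d × E d) R,
      ENNReal.ofReal (‖f (z + w)‖ ^ (2 : ℝ)) := by
  refine LowerSemicontinuous.measurable (lowerSemicontinuous_biSup fun w _ => ?_)
  simp only [ofReal_norm_rpow_two]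
  exact Continuous.lowerSemicontinuous (by fun_prop)

theorem eLpNorm_slice_le {κ : ℝ} {f : E d × E d → F} (hf : Continuous f) (y : E d) :
    eLpNorm (fun v => f (y, v)) 2 volume ≤ sliceConst d κ * Anorm κ 2 f := by
  set V := volume (ball (0 : E d) 1)
  have hV : V ≠ 0 := (measure_ball_pos _ _ one_pos).ne'
  have hV' : V ≠ ⊤ := measure_ball_lt_top.ne
  set S : E d × E d → ℝ≥0∞ := fun z => ⨆ w ∈ closedBall (0 : E d × E d) ((1 : ℝ≥0) : ℝ),
    ENNReal.ofReal (‖f (z + w)‖ ^ (2 : ℝ)) with hS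
  have hVI : V * ∫⁻ v, ‖f (y, v)‖ₑ ^ (2 : ℝ) ≤ ∫⁻ z, S z := by
    rw [Measure.volume_eq_prod, lintegral_prod _ (measurable_iSup_closedBall hf _).aemeasurable]
    have hVy : V = volume (ball y 1) := (Measure.addHaar_ball_center volume y 1).symm
    calc V * ∫⁻ v, ‖f (y, v)‖ₑ ^ (2 : ℝ)
        = ∫⁻ _ in ball y 1, ∫⁻ v, ‖f (y, v)‖ₑ ^ (2 : ℝ) := by
          rw [setLIntegral_const, mul_comm, hVy]
      _ ≤ ∫⁻ y' in ball y 1, ∫⁻ v, S (y', v) := by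
          refine setLIntegral_mono' measurableSet_ball fun y' hy' => lintegral_mono fun v => ?_
          have hw : (y - y', (0 : E d)) ∈ closedBall (0 : E d × E d) ((1 : ℝ≥0) : ℝ) := by
            rw [mem_closedBall_zero_iff, Prod.norm_def]
            rw [mem_ball'] at hy'
            simpa [← dist_eq_norm] using hy'.le
          refine le_trans (le_of_eq ?_) (le_biSup
            (fun w : E d × E d => ENNReal.ofReal (‖f ((y', v) + w)‖ ^ (2 : ℝ))) hw)
          simp
      _ ≤ ∫⁻ y', ∫⁻ v, S (y', v) := setLIntegral_le_lintegral _ _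
  have hI : ∫⁻ v, ‖f (y, v)‖ₑ ^ (2 : ℝ) ≤ V⁻¹ * ∫⁻ z, S z := by
    rw [mul_comm, ← div_eq_mul_inv, ENNReal.le_div_iff_mul_le (.inl hV) (.inl hV'), mul_comm]
    exact hVI
  have hA : (∫⁻ z, S z) ^ (1 / 2 : ℝ) ≤ 2 ^ (κ / 2) * Anorm κ 2 f := by
    have h := le_iSup (fun R : ℝ≥0 => (ENNReal.ofReal (1 + (R : ℝ))) ^ (-(κ / 2)) *
      (∫⁻ z, ⨆ w ∈ closedBall (0 : E d × E d) (R : ℝ),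
        ENNReal.ofReal (‖f (z + w)‖ ^ (2 : ℝ))) ^ (1 / 2 : ℝ)) 1
    have h2 : ENNReal.ofReal (1 + ((1 : ℝ≥0) : ℝ)) = 2 := by norm_num
    rw [h2] at h
    calc (∫⁻ z, S z) ^ (1 / 2 : ℝ)
        = 2 ^ (κ / 2) * (2 ^ (-(κ / 2)) * (∫⁻ z, S z) ^ (1 / 2 : ℝ)) := by
          rw [← mul_assoc, ← ENNReal.rpow_add _ _ (by norm_num) (by norm_num)]
          simp
      _ ≤ _ := by gcongr; exact h
  rw [eLpNorm_two_eq, sliceConst, mul_assoc]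
  calc (∫⁻ v, ‖f (y, v)‖ₑ ^ (2 : ℝ)) ^ (1 / 2 : ℝ) ≤ (V⁻¹ * ∫⁻ z, S z) ^ (1 / 2 : ℝ) := by gcongr
    _ = V⁻¹ ^ (1 / 2 : ℝ) * (∫⁻ z, S z) ^ (1 / 2 : ℝ) :=
        ENNReal.mul_rpow_of_nonneg _ _ (by norm_num)
    _ ≤ _ := by gcongr

theorem eLpNorm_two_le_Anorm {κ : ℝ} (f : E d × E d → F) :
    eLpNorm f 2 volume ≤ Anorm κ 2 f := by
  have h := le_iSup (fun R : ℝ≥0 => (ENNReal.ofReal (1 + (R : ℝ))) ^ (-(κ / 2)) *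
      (∫⁻ z, ⨆ w ∈ closedBall (0 : E d × E d) (R : ℝ),
        ENNReal.ofReal (‖f (z + w)‖ ^ (2 : ℝ))) ^ (1 / 2 : ℝ)) 0
  rw [eLpNorm_two_eq]
  refine le_trans (le_of_eq ?_) h
  simp

theorem memLp_slice {κ : ℝ} {f : E d × E d → F} (hf : Continuous f)
    (hA : Anorm κ 2 f < ⊤) (y : E d) : MemLp (fun v => f (y, v)) 2 volume :=
  ⟨(hf.comp (by fun_prop : Continuous fun v : E d => (y, v))).aestronglyMeasurable,
    (eLpNorm_slice_le hf y).trans_lt (ENNReal.mul_lt_top (sliceConst_ne_top d κ).lt_top hA)⟩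

theorem lintegral_enorm_mul_le {X : Type*} [TopologicalSpace X] [MeasurableSpace X]
    [OpensMeasurableSpace X] (μ : Measure X) {f : X → F} {g : X → G}
    (hf : Continuous f) (hg : Continuous g) :
    ∫⁻ x, ‖f x‖ₑ * ‖g x‖ₑ ∂μ ≤ eLpNorm f 2 μ * eLpNorm g 2 μ := by
  rw [eLpNorm_two_eq, eLpNorm_two_eq]
  exact ENNReal.lintegral_mul_le_Lp_mul_Lq μ Real.HolderConjugate.two_two
    hf.enorm.measurable.aemeasurable hg.enorm.measurable.aemeasurable

end SliceBounds

section Kernel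

theorem measurable_gradNewton (d : ℕ) : Measurable (gradNewton d) := by
  unfold gradNewton
  fun_prop

theorem norm_gradNewton (d : ℕ) (x : E d) :
    ‖gradNewton d x‖ = ((d : ℝ) * (volume (ball (0 : E d) 1)).toReal)⁻¹ *
      (‖x‖ ^ (d : ℝ))⁻¹ * ‖x‖ := by
  rw [gradNewton, norm_smul, norm_inv, Real.norm_of_nonneg (by positivity), mul_inv]

theorem norm_gradNewton_le_rpow (d : ℕ) (x : E d) :
    ‖gradNewton d x‖ ≤ ((d : ℝ) * (volume (ball (0 : E d) 1)).toReal)⁻¹ *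
      ‖x‖ ^ (-((d : ℝ) - 1)) := by
  rw [norm_gradNewton, mul_assoc]
  gcongr
  rcases eq_or_ne x 0 with rfl | hx
  · simp only [norm_zero, mul_zero]
    positivity
  · have h : 0 < ‖x‖ := norm_pos_iff.2 hx
    rw [neg_sub, sub_eq_neg_add, Real.rpow_add h, Real.rpow_neg h.le, Real.rpow_one]

theorem norm_gradNewton_le (d : ℕ) (hd : 1 ≤ d) {x : E d} (hx : 1 ≤ ‖x‖) :
    ‖gradNewton d x‖ ≤ ((d : ℝ) * (volume (ball (0 : E d) 1)).toReal)⁻¹ := by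
  refine (norm_gradNewton_le_rpow d x).trans (mul_le_of_le_one_right (by positivity) ?_)
  have : (1 : ℝ) ≤ d := by exact_mod_cast hd
  exact Real.rpow_le_one_of_one_le_of_nonpos hx (by linarith)

theorem setLIntegral_gradNewton_lt_top (d : ℕ) (hd : 1 ≤ d) :
    ∫⁻ x in ball (0 : E d) 1, ‖gradNewton d x‖ₑ < ⊤ := by
  have h : IntegrableOn (gradNewton d) (ball 0 1) :=
    integrableOn_ball_of_norm_le_rpow (by simpa using hd) (α := (d : ℝ) - 1) (by simp)
      (.of_forall fun x => norm_gradNewton_le_rpow d x)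
      (measurable_gradNewton d).aestronglyMeasurable
  exact h.2

/-- The constant in `lintegral_gradNewton_le`. -/
noncomputable def forceConst (d : ℕ) (κ : ℝ) : ℝ≥0∞ :=
  (∫⁻ x in ball (0 : E d) 1, ‖gradNewton d x‖ₑ) * (sliceConst d κ * sliceConst d κ) +
    ENNReal.ofReal ((d : ℝ) * (volume (ball (0 : E d) 1)).toReal)⁻¹

theorem forceConst_ne_top (d : ℕ) (hd : 1 ≤ d) (κ : ℝ) : forceConst d κ ≠ ⊤ :=
  ENNReal.add_ne_top.2 ⟨ENNReal.mul_ne_top (setLIntegral_gradNewton_lt_top d hd).ne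
    (ENNReal.mul_ne_top (sliceConst_ne_top d κ) (sliceConst_ne_top d κ)), ENNReal.ofReal_ne_top⟩

variable {d : ℕ} {F G : Type*} [NormedAddCommGroup F] [NormedAddCommGroup G]

theorem lintegral_gradNewton_le (hd : 1 ≤ d) {κ : ℝ} {f : E d × E d → F} {g : E d × E d → G}
    (hf : Continuous f) (hg : Continuous g) (x : E d) :
    ∫⁻ y, ‖gradNewton d (x - y)‖ₑ * ∫⁻ v, ‖f (y, v)‖ₑ * ‖g (y, v)‖ₑ ≤
      forceConst d κ * (Anorm κ 2 f * Anorm κ 2 g) := by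
  set B := ENNReal.ofReal ((d : ℝ) * (volume (ball (0 : E d) 1)).toReal)⁻¹
  set k : E d → ℝ≥0∞ := (ball (0 : E d) 1).indicator fun z => ‖gradNewton d z‖ₑ with hk
  have hkm : Measurable k := (measurable_gradNewton d).enorm.indicator measurableSet_ball
  have hkB (z : E d) : ‖gradNewton d z‖ₑ ≤ k z + B := by
    by_cases hz : z ∈ ball (0 : E d) 1
    · simp [hk, hz]
    · refine le_add_left ?_
      rw [← ofReal_norm]
      exact ENNReal.ofReal_le_ofReal (norm_gradNewton_le d hd (by simpa using hz))
  have hslice (y : E d) : ∫⁻ v, ‖f (y, v)‖ₑ * ‖g (y, v)‖ₑ ≤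
      sliceConst d κ * sliceConst d κ * (Anorm κ 2 f * Anorm κ 2 g) := by
    have hy : Continuous fun v : E d => (y, v) := by fun_prop
    refine (lintegral_enorm_mul_le volume (hf.comp hy) (hg.comp hy)).trans ?_
    refine (mul_le_mul' (eLpNorm_slice_le (κ := κ) hf y)
      (eLpNorm_slice_le (κ := κ) hg y)).trans_eq ?_
    ring
  have hm : Measurable fun z : E d × E d => ‖f z‖ₑ * ‖g z‖ₑ :=
    hf.enorm.measurable.mul hg.enorm.measurable
  have htotal : ∫⁻ y, ∫⁻ v, ‖f (y, v)‖ₑ * ‖g (y, v)‖ₑ ≤ Anorm κ 2 f * Anorm κ 2 g := by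
    rw [← lintegral_prod (μ := volume) (ν := volume) _ hm.aemeasurable, ← Measure.volume_eq_prod]
    exact (lintegral_enorm_mul_le volume hf hg).trans
      (mul_le_mul' (eLpNorm_two_le_Anorm f) (eLpNorm_two_le_Anorm g))
  calc ∫⁻ y, ‖gradNewton d (x - y)‖ₑ * ∫⁻ v, ‖f (y, v)‖ₑ * ‖g (y, v)‖ₑ
      ≤ ∫⁻ y, (k (x - y) * (sliceConst d κ * sliceConst d κ * (Anorm κ 2 f * Anorm κ 2 g)) +
          B * ∫⁻ v, ‖f (y, v)‖ₑ * ‖g (y, v)‖ₑ) := by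
        refine lintegral_mono fun y => ?_
        refine (mul_le_mul_left (hkB _) _).trans ?_
        rw [add_mul]
        gcongr
        exact hslice y
    _ = (∫⁻ y, k (x - y)) *
          (sliceConst d κ * sliceConst d κ * (Anorm κ 2 f * Anorm κ 2 g)) +
          B * ∫⁻ y, ∫⁻ v, ‖f (y, v)‖ₑ * ‖g (y, v)‖ₑ := by
        have hkx : Measurable fun y => k (x - y) := hkm.comp (measurable_const.sub measurable_id)
        rw [lintegral_add_left (hkx.mul_const _), lintegral_mul_const _ hkx,
          lintegral_const_mul _ hm.lintegral_prod_right']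
    _ ≤ (∫⁻ z in ball (0 : E d) 1, ‖gradNewton d z‖ₑ) *
          (sliceConst d κ * sliceConst d κ * (Anorm κ 2 f * Anorm κ 2 g)) +
          B * (Anorm κ 2 f * Anorm κ 2 g) := by
        rw [lintegral_sub_left_eq_self k x, lintegral_indicator measurableSet_ball]
        gcongr
    _ = forceConst d κ * (Anorm κ 2 f * Anorm κ 2 g) := by
        rw [forceConst]
        ring

end Kernel

section PhaseDensity

variable {d : ℕ} {α : E d × E d → ℂ}

theorem gradV_eq_comp (hα : ContDiff ℝ 1 α) :
    gradV d α = fun z => (fderiv ℝ α z).comp (ContinuousLinearMap.inr ℝ (E d) (E d)) := by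
  funext z
  have h : HasFDerivAt α (fderiv ℝ α (z.1, z.2)) (z.1, z.2) :=
    (hα.differentiable one_ne_zero (z.1, z.2)).hasFDerivAt
  exact (h.comp z.2 (hasFDerivAt_prodMk_right z.1 z.2)).fderiv

theorem continuous_gradV (hα : ContDiff ℝ 1 α) : Continuous (gradV d α) := by
  rw [gradV_eq_comp hα]
  exact (hα.continuous_fderiv one_ne_zero).clm_comp continuous_const

theorem gradV_sub {β : E d × E d → ℂ} (hα : ContDiff ℝ 1 α) (hβ : ContDiff ℝ 1 β) :
    gradV d (α - β) = gradV d α - gradV d β := by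
  have hs : ContDiff ℝ 1 (α - β) := hα.sub hβ
  rw [gradV_eq_comp hα, gradV_eq_comp hβ, gradV_eq_comp hs]
  funext z
  rw [fderiv_sub (hα.differentiable one_ne_zero z) (hβ.differentiable one_ne_zero z)]
  ext
  simp

theorem integrable_conj_smul_gradV {y : E d}
    (hα : MemLp (fun v => α (y, v)) 2) (hβ : MemLp (fun v => gradV d α (y, v)) 2) :
    Integrable fun v => (starRingEnd ℂ) (α (y, v)) • gradV d α (y, v) :=
  memLp_one_iff_integrable.1 (hβ.smul (p := 2) (r := 1) hα.star)

theorem phaseDensity_apply {y : E d} (hα : MemLp (fun v => α (y, v)) 2)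
    (hα' : MemLp (fun v => gradV d α (y, v)) 2) (u : E d) :
    phaseDensity d α y u = ∫ v, (starRingEnd ℂ) (α (y, v)) * gradV d α (y, v) u := by
  rw [phaseDensity, ContinuousLinearMap.integral_apply (integrable_conj_smul_gradV hα hα')]
  rfl

theorem enorm_phaseDensity_le (α : E d × E d → ℂ) (y : E d) :
    ‖phaseDensity d α y‖ₑ ≤ ∫⁻ v, ‖α (y, v)‖ₑ * ‖gradV d α (y, v)‖ₑ := by
  refine (enorm_integral_le_lintegral_enorm _).trans_eq (lintegral_congr fun v => ?_)
  rw [enorm_smul]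
  simp [← ofReal_norm]

theorem stronglyMeasurable_phaseDensity (hα : ContDiff ℝ 1 α) :
    StronglyMeasurable (phaseDensity d α) := by
  have h : Continuous fun z : E d × E d => (starRingEnd ℂ) (α z) • gradV d α z :=
    (Complex.continuous_conj.comp hα.continuous).smul (continuous_gradV hα)
  exact h.stronglyMeasurable.integral_prod_right'

theorem integrable_phaseDensity_gradNewton (hd : 1 ≤ d) {κ : ℝ} (hα : ContDiff ℝ 1 α)
    (hA : Anorm κ 2 α < ⊤) (hA' : Anorm κ 2 (gradV d α) < ⊤) (x : E d) :
    Integrable fun y => phaseDensity d α y (gradNewton d (x - y)) := by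
  have hu : StronglyMeasurable fun y => gradNewton d (x - y) :=
    ((measurable_gradNewton d).comp (measurable_const.sub measurable_id)).stronglyMeasurable
  refine ⟨(isBoundedBilinearMap_apply.continuous.comp_stronglyMeasurable
    ((stronglyMeasurable_phaseDensity hα).prodMk hu)).aestronglyMeasurable, ?_⟩
  refine lt_of_le_of_lt (lintegral_mono fun y => ?_)
    ((lintegral_gradNewton_le hd (κ := κ) hα.continuous (continuous_gradV hα) x).trans_lt
      (ENNReal.mul_lt_top (forceConst_ne_top d hd κ).lt_top (ENNReal.mul_lt_top hA hA')))
  refine (ContinuousLinearMap.le_opENorm _ _).trans ?_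
  rw [mul_comm]
  gcongr
  exact enorm_phaseDensity_le α y

theorem memLp_apply {X : Type*} [MeasurableSpace X] {μ : Measure X} {L : X → E d →L[ℝ] ℂ}
    (hL : MemLp L 2 μ) (u : E d) : MemLp (fun x => L x u) 2 μ :=
  (ContinuousLinearMap.apply ℝ ℂ u).comp_memLp' hL

theorem integrable_conj_mul_apply {X : Type*} [MeasurableSpace X] {μ : Measure X} {f : X → ℂ}
    {L : X → E d →L[ℝ] ℂ} (hf : MemLp f 2 μ) (hL : MemLp L 2 μ) (u : E d) :
    Integrable (fun x => (starRingEnd ℂ) (f x) * L x u) μ :=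
  hf.star.integrable_mul (memLp_apply hL u)

theorem integral_conj_mul_gradV_eq {α β : E d × E d → ℂ} (hα : ContDiff ℝ 1 α)
    (hβ : ContDiff ℝ 1 β) {y : E d}
    (mα : MemLp (fun v => α (y, v)) 2) (mα' : MemLp (fun v => gradV d α (y, v)) 2)
    (mβ : MemLp (fun v => β (y, v)) 2) (mβ' : MemLp (fun v => gradV d β (y, v)) 2) (u : E d) :
    ∫ v, (starRingEnd ℂ) (α (y, v)) * gradV d β (y, v) u =
      -∫ v, (starRingEnd ℂ) (gradV d α (y, v) u) * β (y, v) := by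
  have hy : ContDiff ℝ 1 fun v : E d => (y, v) := by fun_prop
  have hstar (v : E d) : fderiv ℝ (fun v => (starRingEnd ℂ) (α (y, v))) v u =
      (starRingEnd ℂ) (gradV d α (y, v) u) := by
    have h : fderiv ℝ (fun v => star (α (y, v))) v = _ := fderiv_star
    exact congrArg (fun L : E d →L[ℝ] ℂ => L u) h
  have key := integral_mul_fderiv_eq_neg_fderiv_mul_of_integrable (μ := volume)
    (f := fun v => (starRingEnd ℂ) (α (y, v))) (g := fun v => β (y, v)) (v := u)
    (by simp only [hstar]; exact (memLp_apply mα' u).star.integrable_mul mβ)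
    (integrable_conj_mul_apply mα mβ' u)
    (mα.star.integrable_mul mβ)
    (fun v _ => ((hα.comp hy).differentiable one_ne_zero v).star)
    (fun v _ => (hβ.comp hy).differentiable one_ne_zero v)
  simp only [hstar] at key
  exact key

theorem enorm_phaseDensity_sub_apply_le {α₁ α₂ : E d × E d → ℂ} (h₁ : ContDiff ℝ 1 α₁)
    (h₂ : ContDiff ℝ 1 α₂) {y : E d}
    (m₁ : MemLp (fun v => α₁ (y, v)) 2) (m₁' : MemLp (fun v => gradV d α₁ (y, v)) 2)
    (m₂ : MemLp (fun v => α₂ (y, v)) 2) (m₂' : MemLp (fun v => gradV d α₂ (y, v)) 2) (u : E d) :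
    ‖phaseDensity d α₁ y u - phaseDensity d α₂ y u‖ₑ ≤
      ‖u‖ₑ * (∫⁻ v, ‖(α₁ - α₂) (y, v)‖ₑ * ‖gradV d α₁ (y, v)‖ₑ) +
        ‖u‖ₑ * ∫⁻ v, ‖(α₁ - α₂) (y, v)‖ₑ * ‖gradV d α₂ (y, v)‖ₑ := by
  have hβ : ContDiff ℝ 1 (α₁ - α₂) := h₁.sub h₂
  have mβ : MemLp (fun v => (α₁ - α₂) (y, v)) 2 := m₁.sub m₂
  have mβ' : MemLp (fun v => gradV d (α₁ - α₂) (y, v)) 2 := by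
    rw [gradV_sub h₁ h₂]
    exact m₁'.sub m₂'
  have hsplit : phaseDensity d α₁ y u - phaseDensity d α₂ y u =
      (∫ v, (starRingEnd ℂ) ((α₁ - α₂) (y, v)) * gradV d α₁ (y, v) u) -
        ∫ v, (starRingEnd ℂ) (gradV d α₂ (y, v) u) * (α₁ - α₂) (y, v) := by
    rw [sub_eq_add_neg (∫ v, (starRingEnd ℂ) ((α₁ - α₂) (y, v)) * gradV d α₁ (y, v) u),
      ← integral_conj_mul_gradV_eq h₂ hβ m₂ m₂' mβ mβ' u, phaseDensity_apply m₁ m₁',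
      phaseDensity_apply m₂ m₂',
      ← integral_sub (integrable_conj_mul_apply m₁ m₁' u) (integrable_conj_mul_apply m₂ m₂' u),
      ← integral_add (integrable_conj_mul_apply mβ m₁' u) (integrable_conj_mul_apply m₂ mβ' u)]
    refine integral_congr_ae (.of_forall fun v => ?_)
    simp only [gradV_sub h₁ h₂, Pi.sub_apply, map_sub, sub_apply]
    ring
  have hbound (L : E d →L[ℝ] ℂ) (c : ℂ) : ‖c‖ₑ * ‖L u‖ₑ ≤ ‖u‖ₑ * (‖c‖ₑ * ‖L‖ₑ) := by
    refine (mul_le_mul_right (ContinuousLinearMap.le_opENorm L u) _).trans_eq ?_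
    ring
  rw [hsplit]
  refine enorm_sub_le.trans (add_le_add ?_ ?_)
  all_goals
    refine (enorm_integral_le_lintegral_enorm _).trans ?_
    rw [← lintegral_const_mul' _ _ enorm_ne_top]
    refine lintegral_mono fun v => ?_
    rw [enorm_mul]
  · rw [RCLike.enorm_conj]
    exact hbound _ _
  · rw [RCLike.enorm_conj, mul_comm]
    exact hbound _ _

end PhaseDensity

/-- Lipschitz estimate for the phase force: there is `C = C(d,κ) > 0` with
`‖K₁ − K₂‖_{L^∞} ≤ C (‖∇ᵥα₁‖_{A^{κ,2}} + ‖∇ᵥα₂‖_{A^{κ,2}}) ‖α₁ − α₂‖_{A^{κ,2}}`. -/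
theorem statement17 (d : ℕ) (hd : 3 ≤ d) (κ : ℝ) (hκ : 2 * (d : ℝ) ≤ κ) :
    ∃ C > 0, ∀ α₁ α₂ : E d × E d → ℂ, ContDiff ℝ 1 α₁ → ContDiff ℝ 1 α₂ →
      Anorm κ 2 α₁ < ⊤ → Anorm κ 2 α₂ < ⊤ →
      Anorm κ 2 (gradV d α₁) < ⊤ → Anorm κ 2 (gradV d α₂) < ⊤ → ∀ x : E d,
      ENNReal.ofReal ‖phaseForce d α₁ x - phaseForce d α₂ x‖ ≤
        ENNReal.ofReal C * (Anorm κ 2 (gradV d α₁) + Anorm κ 2 (gradV d α₂)) *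
          Anorm κ 2 (α₁ - α₂) := by
  have hd1 : 1 ≤ d := by omega
  refine ⟨(forceConst d κ).toReal + 1, by positivity, ?_⟩
  intro α₁ α₂ h₁ h₂ hA₁ hA₂ hA₁' hA₂' x
  have c₁ := continuous_gradV h₁
  have c₂ := continuous_gradV h₂
  have hβ : Continuous (α₁ - α₂) := h₁.continuous.sub h₂.continuous
  have hm : Measurable fun z : E d × E d => ‖(α₁ - α₂) z‖ₑ * ‖gradV d α₁ z‖ₑ :=
    hβ.enorm.measurable.mul c₁.enorm.measurable
  have hum : Measurable fun y => ‖gradNewton d (x - y)‖ₑ *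
      ∫⁻ v, ‖(α₁ - α₂) (y, v)‖ₑ * ‖gradV d α₁ (y, v)‖ₑ :=
    ((measurable_gradNewton d).comp (measurable_const.sub measurable_id)).enorm.mul
      hm.lintegral_prod_right'
  have hC : forceConst d κ ≤ ENNReal.ofReal ((forceConst d κ).toReal + 1) := by
    refine (ENNReal.ofReal_toReal (forceConst_ne_top d hd1 κ)).symm.le.trans ?_
    exact ENNReal.ofReal_le_ofReal (by linarith)
  have hdiff : phaseForce d α₁ x - phaseForce d α₂ x =
      -∫ y, (phaseDensity d α₁ y (gradNewton d (x - y)) -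
        phaseDensity d α₂ y (gradNewton d (x - y))) := by
    rw [integral_sub (integrable_phaseDensity_gradNewton hd1 h₁ hA₁ hA₁' x)
      (integrable_phaseDensity_gradNewton hd1 h₂ hA₂ hA₂' x), phaseForce, phaseForce]
    ring
  rw [ofReal_norm, hdiff, enorm_neg]
  calc _ ≤ ∫⁻ y, ‖phaseDensity d α₁ y (gradNewton d (x - y)) -
        phaseDensity d α₂ y (gradNewton d (x - y))‖ₑ := enorm_integral_le_lintegral_enorm _
    _ ≤ ∫⁻ y, (‖gradNewton d (x - y)‖ₑ *
          (∫⁻ v, ‖(α₁ - α₂) (y, v)‖ₑ * ‖gradV d α₁ (y, v)‖ₑ) +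
        ‖gradNewton d (x - y)‖ₑ * ∫⁻ v, ‖(α₁ - α₂) (y, v)‖ₑ * ‖gradV d α₂ (y, v)‖ₑ) :=
        lintegral_mono fun y => enorm_phaseDensity_sub_apply_le h₁ h₂
          (memLp_slice h₁.continuous hA₁ y) (memLp_slice c₁ hA₁' y)
          (memLp_slice h₂.continuous hA₂ y) (memLp_slice c₂ hA₂' y) _
    _ ≤ forceConst d κ * (Anorm κ 2 (α₁ - α₂) * Anorm κ 2 (gradV d α₁)) +
        forceConst d κ * (Anorm κ 2 (α₁ - α₂) * Anorm κ 2 (gradV d α₂)) := by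
        rw [lintegral_add_left hum]
        exact add_le_add (lintegral_gradNewton_le hd1 hβ c₁ x)
          (lintegral_gradNewton_le hd1 hβ c₂ x)
    _ = forceConst d κ * (Anorm κ 2 (gradV d α₁) + Anorm κ 2 (gradV d α₂)) *
          Anorm κ 2 (α₁ - α₂) := by ring
    _ ≤ _ := by gcongr
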